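/- Let a, b be complex numbers such that (a+b+1)/2 is not a nonpositive integer. Then ₂F₁(a, b; (a+b+1)/2; 1/2) = [Γ(1/2) Γ((a+b+1)/2)] / [Γ((a+1)/2) Γ((b+1)/2)]. -/

import Mathlib

/-- Pochhammer symbol (rising factorial) `(c)_k = c (c+1) ⋯ (c+k-1)` for complex `c`. -/
noncomputable def poch (c : ℂ) (k : ℕ) : ℂ := ∏ l ∈ Finset.range k, (c + l)

/-- Generalized hypergeometric series `ₚF_q(a; b; x) = Σ_k (a₁)_k⋯(a_p)_k / ((b₁)_k⋯(b_q)_k) · x^k/k!`. -/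
noncomputable def pFq (a b : List ℂ) (x : ℂ) : ℂ :=
  ∑' k : ℕ, ((a.map (fun c => poch c k)).prod / (b.map (fun c => poch c k)).prod)
    * x ^ k / (Nat.factorial k)

/-- `c` is not a nonpositive integer, i.e. `c ≠ 0, -1, -2, …`. -/
def NotNonposInt (c : ℂ) : Prop := ∀ n : ℕ, c ≠ -(n : ℂ)

open Filter Topology PowerSeries

theorem poch_zero (c : ℂ) : poch c 0 = 1 := by simp [poch]

theorem poch_succ (c : ℂ) (k : ℕ) : poch c (k + 1) = poch c k * (c + k) :=
  Finset.prod_range_succ _ _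

theorem poch_one (k : ℕ) : poch 1 k = Nat.factorial k := by
  induction k with
  | zero => simp [poch_zero]
  | succ k ih => rw [poch_succ, ih, Nat.factorial_succ]; push_cast; ring

theorem NotNonposInt.add_natCast_ne_zero {c : ℂ} (h : NotNonposInt c) (k : ℕ) : c + k ≠ 0 :=
  fun h0 => h k (eq_neg_of_add_eq_zero_left h0)

theorem NotNonposInt.add_natCast {c : ℂ} (h : NotNonposInt c) (m : ℕ) :
    NotNonposInt (c + m) := fun n hn => h (m + n) (by push_cast; linear_combination hn)

theorem NotNonposInt.poch_ne_zero {c : ℂ} (h : NotNonposInt c) (k : ℕ) : poch c k ≠ 0 :=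
  Finset.prod_ne_zero_iff.2 fun l _ => h.add_natCast_ne_zero l

theorem poch_eq_ascPochhammer_eval (c : ℂ) (k : ℕ) : poch c k = (ascPochhammer ℂ k).eval c := by
  induction k with
  | zero => simp [poch_zero]
  | succ k ih => rw [poch_succ, ih, ascPochhammer_succ_eval]

theorem norm_poch_le (c : ℂ) (k : ℕ) : ‖poch c k‖ ≤ ‖poch (‖c‖ : ℂ) k‖ := by
  simp only [poch, norm_prod]
  refine Finset.prod_le_prod (fun _ _ => norm_nonneg _) fun l _ => ?_
  have h : ‖((‖c‖ : ℂ) + l)‖ = ‖c‖ + l := by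
    rw [show ((‖c‖ : ℂ) + l) = ((‖c‖ + l : ℝ) : ℂ) by push_cast; rfl,
      Complex.norm_of_nonneg (by positivity)]
  rw [h]
  exact (norm_add_le _ _).trans (by simp)

theorem norm_poch_one_le {c : ℂ} (hc : 1 ≤ c.re) (k : ℕ) : ‖poch 1 k‖ ≤ ‖poch c k‖ := by
  simp only [poch, norm_prod]
  refine Finset.prod_le_prod (fun _ _ => norm_nonneg _) fun l _ => ?_
  have h : ‖(1 + l : ℂ)‖ = 1 + l := by
    rw [show (1 + l : ℂ) = ((1 + l : ℝ) : ℂ) by push_cast; rfl,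
      Complex.norm_of_nonneg (by positivity)]
  rw [h]
  calc (1 + l : ℝ) ≤ (c + l).re := by simpa using hc
    _ ≤ ‖c + l‖ := Complex.re_le_norm _

/-- The coefficient of `x ^ k` in the Gauss series `₂F₁(a, b; c; x)`. -/
noncomputable def gaussCoeff (a b c : ℂ) (k : ℕ) : ℂ :=
  poch a k * poch b k / poch c k / Nat.factorial k

theorem gaussCoeff_zero (a b c : ℂ) : gaussCoeff a b c 0 = 1 := by simp [gaussCoeff, poch_zero]

theorem gaussCoeff_succ (a b c : ℂ) (k : ℕ) :
    gaussCoeff a b c (k + 1) = (a + k) * (b + k) / ((c + k) * (k + 1)) * gaussCoeff a b c k := by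
  simp only [gaussCoeff, poch_succ, Nat.factorial_succ, Nat.cast_mul, Nat.cast_succ,
    div_eq_mul_inv, mul_inv]
  ring

theorem pFq_two_one (a b c x : ℂ) : pFq [a, b] [c] x = ∑' k, gaussCoeff a b c k * x ^ k := by
  simp only [pFq, gaussCoeff, List.map_cons, List.map_nil, List.prod_cons, List.prod_nil, mul_one]
  exact tsum_congr fun k => by ring

theorem tendsto_add_natCast_div_add_natCast (a c : ℂ) :
    Tendsto (fun k : ℕ => (a + k) / (c + k)) atTop (𝓝 1) := by
  simpa using tendsto_add_mul_div_add_mul_atTop_nhds a c 1 (one_ne_zero (α := ℂ))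

theorem tendsto_gaussRatio (a b c d : ℂ) :
    Tendsto (fun k : ℕ => (a + k) * (b + k) / ((c + k) * (d + k)) * (1 / 2))
      atTop (𝓝 (1 / 2)) := by
  have h := ((tendsto_add_natCast_div_add_natCast a c).mul
    (tendsto_add_natCast_div_add_natCast b d)).mul_const (1 / 2 : ℂ)
  simp only [one_mul] at h
  exact h.congr fun k => by rw [div_mul_div_comm]

theorem summable_norm_of_succ_eq_mul {f q : ℕ → ℂ} (hf : ∀ k, f (k + 1) = q k * f k)
    (hq : Tendsto q atTop (𝓝 (1 / 2))) : Summable fun k => ‖f k‖ := by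
  have h : ∀ᶠ k in atTop, ‖q k‖ < 3 / 4 := by
    refine hq.norm.eventually_lt_const ?_
    norm_num
  refine summable_of_ratio_norm_eventually_le (r := 3 / 4) (by norm_num) ?_
  filter_upwards [h] with k hk
  rw [norm_norm, norm_norm, hf, norm_mul]
  gcongr

theorem summable_norm_gaussCoeff (a b c : ℂ) :
    Summable fun k => ‖gaussCoeff a b c k * (1 / 2) ^ k‖ := by
  refine summable_norm_of_succ_eq_mul (fun k => ?_) (tendsto_gaussRatio a b c 1)
  rw [gaussCoeff_succ, pow_succ, add_comm (1 : ℂ)]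
  ring

theorem coeff_hypergeometric_operator (a b c : ℂ) (f : ℂ⟦X⟧) (n : ℕ) :
    coeff n (X * (1 - X) * d⁄dX ℂ (d⁄dX ℂ f) + (C c - (C a + C b + 1) * X) * d⁄dX ℂ f
      - C a * C b * f) =
    (c + n) * (n + 1) * coeff (n + 1) f - (a + n) * (b + n) * coeff n f := by
  have e : X * (1 - X) * d⁄dX ℂ (d⁄dX ℂ f) + (C c - (C a + C b + 1) * X) * d⁄dX ℂ f
      - C a * C b * f = X * d⁄dX ℂ (d⁄dX ℂ f) - X * (X * d⁄dX ℂ (d⁄dX ℂ f)) + C c * d⁄dX ℂ f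
      - C (a + b + 1) * (X * d⁄dX ℂ f) - C (a * b) * f := by
    simp only [map_add, map_mul, map_one]; ring
  have key : ∀ p q : ℂ, coeff n (X * d⁄dX ℂ (d⁄dX ℂ f) - X * (X * d⁄dX ℂ (d⁄dX ℂ f))
      + C c * d⁄dX ℂ f - C p * (X * d⁄dX ℂ f) - C q * f) =
      (c + n) * (n + 1) * coeff (n + 1) f - (n * (n - 1) + p * n + q) * coeff n f := by
    intro p q
    rcases n with _ | _ | n <;>
    simp [coeff_succ_X_mul, coeff_derivative, coeff_C_mul, -coeff_zero_eq_constantCoeff,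
      coeff_zero_X_mul] <;> ring
  rw [e, key]
  ring

/-- Euler's transformation, as an identity of formal power series. -/
theorem mk_gaussCoeff_euler {a b c : ℂ} (hc : NotNonposInt c) :
    PowerSeries.mk (gaussCoeff (a + b - c) 1 1) * PowerSeries.mk (gaussCoeff (c - a) (c - b) c) =
      PowerSeries.mk (gaussCoeff a b c) := by
  set g := PowerSeries.mk (gaussCoeff (a + b - c) 1 1) with hg
  set f := PowerSeries.mk (gaussCoeff (c - a) (c - b) c) with hf
  have E0 : X * (1 - X) * d⁄dX ℂ (d⁄dX ℂ f) + (C c - (C (c - a) + C (c - b) + 1) * X) * d⁄dX ℂ f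
      - C (c - a) * C (c - b) * f = 0 := by
    ext n
    rw [coeff_hypergeometric_operator, hf, coeff_mk, coeff_mk, gaussCoeff_succ]
    have := hc.add_natCast_ne_zero n
    have := Nat.cast_add_one_ne_zero (R := ℂ) n
    simp only [map_zero]
    field_simp
    ring
  have E1 : (1 - X) * d⁄dX ℂ g - C (a + b - c) * g = 0 := by
    have e : (1 - X) * d⁄dX ℂ g - C (a + b - c) * g =
      d⁄dX ℂ g - X * d⁄dX ℂ g - C (a + b - c) * g := by ring
    rw [e]
    ext n
    have h1 : coeff (n + 1) g * (n + 1) = (a + b - c + n) * coeff n g := by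
      rw [hg, coeff_mk, coeff_mk, gaussCoeff_succ]
      have := Nat.cast_add_one_ne_zero (R := ℂ) n
      rw [add_comm (1 : ℂ)]
      field_simp
    generalize a + b - c = s at h1
    rcases n with _ | n <;>
    simp [coeff_derivative, coeff_succ_X_mul, coeff_zero_X_mul, coeff_C_mul,
      -coeff_zero_eq_constantCoeff] at h1 ⊢ <;>
    linear_combination h1
  have E2 : (1 - X) * d⁄dX ℂ (d⁄dX ℂ g) - (C (a + b - c) + 1) * d⁄dX ℂ g = 0 := by
    have := congrArg (d⁄dX ℂ) E1
    simp only [map_sub, Derivation.leibniz, derivative_X, derivative_C, smul_eq_mul, map_zero,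
      Derivation.map_one_eq_zero] at this
    simp only [map_sub]
    linear_combination this
  have E : X * (1 - X) * d⁄dX ℂ (d⁄dX ℂ (g * f))
      + (C c - (C a + C b + 1) * X) * d⁄dX ℂ (g * f) - C a * C b * (g * f) = 0 := by
    simp only [map_add, Derivation.leibniz, smul_eq_mul]
    simp only [map_sub, map_add] at E0 E1 E2
    linear_combination X * f * E2 + (2 * X * d⁄dX ℂ f + C c * f) * E1 + g * E0
  ext n
  induction n with
  | zero => simp [hg, hf, gaussCoeff_zero]
  | succ n ih =>
    have h := congrArg (coeff n) E
    rw [coeff_hypergeometric_operator, ih, coeff_mk] at h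
    rw [coeff_mk, gaussCoeff_succ]
    have := hc.add_natCast_ne_zero n
    have := Nat.cast_add_one_ne_zero (R := ℂ) n
    simp only [map_zero] at h
    field_simp
    linear_combination h

theorem tsum_gaussCoeff_binomial (s : ℂ) :
    ∑' k, gaussCoeff s 1 1 k * (1 / 2) ^ k = 2 ^ s := by
  have h := (Complex.one_div_one_sub_cpow_hasFPowerSeriesOnBall_zero s).hasSum
    (y := 1 / 2) (by simp [enorm])
  have e : (1 : ℂ) / (1 - (0 + 1 / 2)) ^ s = 2 ^ s := by
    rw [show (1 : ℂ) - (0 + 1 / 2) = 2⁻¹ by norm_num, Complex.inv_cpow]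
    · simp
    · rw [show (2 : ℂ) = ((2 : ℝ) : ℂ) by norm_num, Complex.arg_ofReal_of_nonneg (by norm_num)]
      exact Real.pi_pos.ne
  rw [e] at h
  rw [← h.tsum_eq]
  refine tsum_congr fun k => ?_
  have hk : (Nat.factorial k : ℂ) * Ring.choose (s + k - 1) k = poch s k := by
    rw [← Ring.multichoose_eq, ← nsmul_eq_mul, Ring.factorial_nsmul_multichoose_eq_ascPochhammer,
      Polynomial.ascPochhammer_smeval_eq_eval, poch_eq_ascPochhammer_eval]
  have hk0 : (Nat.factorial k : ℂ) ≠ 0 := by exact_mod_cast k.factorial_ne_zero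
  simp only [gaussCoeff, ← hk, poch_one, FormalMultilinearSeries.ofScalars_apply_eq, smul_eq_mul]
  field_simp

/-- Euler's transformation at `1/2`. -/
theorem tsum_gaussCoeff_euler {a b c : ℂ} (hc : NotNonposInt c) :
    ∑' k, gaussCoeff a b c k * (1 / 2) ^ k =
      2 ^ (a + b - c) * ∑' k, gaussCoeff (c - a) (c - b) c k * (1 / 2) ^ k := by
  rw [← tsum_gaussCoeff_binomial, tsum_mul_tsum_eq_tsum_sum_antidiagonal_of_summable_norm
    (summable_norm_gaussCoeff _ _ _) (summable_norm_gaussCoeff _ _ _)]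
  refine tsum_congr fun k => ?_
  have h := congrArg (coeff k) (mk_gaussCoeff_euler (a := a) (b := b) hc)
  rw [coeff_mul, coeff_mk] at h
  rw [← h, Finset.sum_mul]
  refine Finset.sum_congr rfl fun p hp => ?_
  rw [← Finset.HasAntidiagonal.mem_antidiagonal.1 hp, coeff_mk, coeff_mk, pow_add]
  ring

/-- The Gauss series `₂F₁(A, 1 - A; c; 1/2)`. -/
noncomputable def baileySum (A c : ℂ) : ℂ := ∑' k, gaussCoeff A (1 - A) c k * (1 / 2) ^ k

theorem poch_add_two (c : ℂ) (k : ℕ) :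
    poch (c + 2) k * (c * (c + 1)) = poch c k * ((c + k) * (c + k + 1)) := by
  induction k with
  | zero => simp [poch_zero]
  | succ k ih =>
    rw [poch_succ, poch_succ]
    push_cast
    linear_combination (c + 2 + k) * ih

theorem baileySum_add_two {A c : ℂ} (hc : NotNonposInt c) :
    c * (c + 1) * baileySum A c = (c + A) * (c + 1 - A) * baileySum A (c + 2) := by
  set t : ℕ → ℂ := fun k => gaussCoeff A (1 - A) c k * (1 / 2) ^ k with ht
  set u : ℕ → ℂ := fun k => gaussCoeff A (1 - A) (c + 2) k * (1 / 2) ^ k with hu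
  have hc2 : NotNonposInt (c + 2) := mod_cast hc.add_natCast 2
  have hu_succ : ∀ k : ℕ, u (k + 1) =
      (A + k) * (1 - A + k) / ((c + 2 + k) * (k + 1)) * (1 / 2) * u k := fun k => by
    simp only [hu, gaussCoeff_succ, pow_succ]; ring
  have htu : ∀ k : ℕ, c * (c + 1) * t k = (c + k) * (c + k + 1) * u k := fun k => by
    have h1 := hc.poch_ne_zero k
    have h2 := hc2.poch_ne_zero k
    simp only [ht, hu, gaussCoeff]
    field_simp
    linear_combination poch A k * poch (1 - A) k / Nat.factorial k * poch_add_two c k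
  set v : ℕ → ℂ := fun k => (A + k) * (1 - A + k) * u k with hv
  have hv0 : Tendsto v atTop (𝓝 0) := by
    refine (summable_norm_of_succ_eq_mul (f := v) (fun k => ?_)
      (tendsto_gaussRatio (A + 1) (2 - A) (c + 2) 1)).of_norm.tendsto_atTop_zero
    simp only [hv, hu_succ]
    push_cast
    rw [add_comm (1 : ℂ) (k : ℂ)]
    ring
  have hG : Tendsto (fun n : ℕ => -2 * n * (c + 1 + n) * u n) atTop (𝓝 0) := by
    rw [← tendsto_add_atTop_iff_nat 1]
    refine (neg_zero (G := ℂ) ▸ hv0.neg).congr fun k => ?_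
    have := hc2.add_natCast_ne_zero k
    have := Nat.cast_add_one_ne_zero (R := ℂ) k
    simp only [hv, hu_succ]
    push_cast
    field_simp
    ring
  have hsum : ∀ n : ℕ, ∑ k ∈ Finset.range n,
      (c * (c + 1) * t k - (c + A) * (c + 1 - A) * u k) = -2 * n * (c + 1 + n) * u n := by
    intro n
    induction n with
    | zero => simp
    | succ n ih =>
      have := hc2.add_natCast_ne_zero n
      have := Nat.cast_add_one_ne_zero (R := ℂ) n
      rw [Finset.sum_range_succ, ih, htu, hu_succ]
      push_cast
      field_simp
      ring
  have hs := ((summable_norm_gaussCoeff A (1 - A) c).of_norm.hasSum.mul_left (c * (c + 1))).sub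
    ((summable_norm_gaussCoeff A (1 - A) (c + 2)).of_norm.hasSum.mul_left
      ((c + A) * (c + 1 - A)))
  have := tendsto_nhds_unique (hs.tendsto_sum_nat.congr hsum) hG
  exact sub_eq_zero.1 this

theorem poch_mul_baileySum {A c : ℂ} (hc : NotNonposInt c) (n : ℕ) :
    poch (c / 2) n * poch ((c + 1) / 2) n * baileySum A c =
      poch ((c + A) / 2) n * poch ((c + 1 - A) / 2) n * baileySum A (c + 2 * n) := by
  induction n with
  | zero => simp [poch_zero]
  | succ n ih =>
    have h := baileySum_add_two (A := A) (c := c + 2 * n) (mod_cast hc.add_natCast (2 * n))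
    simp only [poch_succ]
    push_cast
    rw [show c + 2 * (n + 1 : ℂ) = c + 2 * n + 2 by ring]
    linear_combination (c / 2 + n) * ((c + 1) / 2 + n) * ih
      + poch ((c + A) / 2) n * poch ((c + 1 - A) / 2) n / 4 * h

theorem tendsto_inv_poch_add_two_mul (c : ℂ) (k : ℕ) :
    Tendsto (fun n : ℕ => (poch (c + 2 * n) k)⁻¹) atTop (𝓝 (if k = 0 then 1 else 0)) := by
  induction k with
  | zero => simp [poch_zero]
  | succ k ih =>
    have h : Tendsto (fun n : ℕ => (c + 2 * n + k)⁻¹) atTop (𝓝 0) := by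
      have := tendsto_add_mul_div_add_mul_atTop_nhds (1 : ℂ) (c + k) 0 (two_ne_zero (α := ℂ))
      simp only [zero_mul, add_zero, zero_div, one_div] at this
      exact this.congr fun n => by rw [add_right_comm]
    simpa [poch_succ, mul_comm] using ih.mul h

theorem tendsto_baileySum (A c : ℂ) :
    Tendsto (fun n : ℕ => baileySum A (c + 2 * n)) atTop (𝓝 1) := by
  have h1 : ∑' k : ℕ, (if k = 0 then (1 : ℂ) else 0) = 1 := tsum_ite_eq 0 _
  rw [← h1]
  refine tendsto_tsum_of_dominated_convergence
    (summable_norm_gaussCoeff (‖A‖ : ℂ) (‖1 - A‖ : ℂ) 1) (fun k => ?_) ?_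
  · have h := (tendsto_inv_poch_add_two_mul c k).const_mul
      (poch A k * poch (1 - A) k / Nat.factorial k * (1 / 2) ^ k)
    convert h using 1
    · ext n
      simp only [gaussCoeff]
      ring
    · congr 1
      split_ifs with hk
      · simp [hk, poch_zero]
      · simp
  · obtain ⟨N, hN⟩ := exists_nat_ge (1 - c.re)
    filter_upwards [eventually_ge_atTop N] with n hn k
    have hre : 1 ≤ (c + 2 * n).re := by
      have : (N : ℝ) ≤ n := by exact_mod_cast hn
      have : (0 : ℝ) ≤ n := n.cast_nonneg
      simp
      linarith
    have hpos : 0 < ‖poch 1 k‖ := by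
      rw [poch_one, norm_pos_iff]
      exact_mod_cast k.factorial_ne_zero
    simp only [gaussCoeff, norm_mul, norm_div]
    gcongr
    · exact norm_poch_le _ _
    · exact norm_poch_le _ _
    · exact norm_poch_one_le hre k

theorem GammaSeq_eq_div_poch (s : ℂ) (n : ℕ) :
    Complex.GammaSeq s n = (n : ℂ) ^ s * Nat.factorial n / poch s (n + 1) := rfl

theorem tendsto_inv_GammaSeq (s : ℂ) :
    Tendsto (fun n => (Complex.GammaSeq s n)⁻¹) atTop (𝓝 (Complex.Gamma s)⁻¹) := by
  by_cases h : Complex.Gamma s = 0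
  · obtain ⟨m, hm⟩ := (Complex.Gamma_eq_zero_iff s).1 h
    rw [h, inv_zero]
    refine tendsto_const_nhds.congr' ?_
    filter_upwards [eventually_ge_atTop m] with n hn
    have : poch s (n + 1) = 0 :=
      Finset.prod_eq_zero (Finset.mem_range.2 (Nat.lt_succ_of_le hn)) (by rw [hm]; ring)
    rw [GammaSeq_eq_div_poch, this, div_zero, inv_zero]
  · exact (Complex.GammaSeq_tendsto_Gamma s).inv₀ h

/-- Bailey's evaluation of `₂F₁(A, 1 - A; c; 1/2)`. -/
theorem inv_Gamma_mul_baileySum {A c : ℂ} (hc : NotNonposInt c) :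
    (Complex.Gamma (c / 2))⁻¹ * (Complex.Gamma ((c + 1) / 2))⁻¹ * baileySum A c =
      (Complex.Gamma ((c + A) / 2))⁻¹ * (Complex.Gamma ((c + 1 - A) / 2))⁻¹ := by
  have hl := ((tendsto_inv_GammaSeq (c / 2)).mul
    (tendsto_inv_GammaSeq ((c + 1) / 2))).mul_const (baileySum A c)
  have hr := ((tendsto_inv_GammaSeq ((c + A) / 2)).mul
    (tendsto_inv_GammaSeq ((c + 1 - A) / 2))).mul
    ((tendsto_baileySum A c).comp (tendsto_add_atTop_nat 1))
  rw [mul_one] at hr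
  refine tendsto_nhds_unique (hl.congr' ?_) hr
  filter_upwards [eventually_ne_atTop 0] with n hn
  have hn' : (n : ℂ) ≠ 0 := Nat.cast_ne_zero.2 hn
  have hpow : (n : ℂ) ^ (c / 2) * (n : ℂ) ^ ((c + 1) / 2) =
      (n : ℂ) ^ ((c + A) / 2) * (n : ℂ) ^ ((c + 1 - A) / 2) := by
    rw [← Complex.cpow_add _ _ hn', ← Complex.cpow_add _ _ hn']
    ring_nf
  have h := poch_mul_baileySum (A := A) hc (n + 1)
  simp only [GammaSeq_eq_div_poch, inv_div, Function.comp_apply, div_mul_div_comm]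
  rw [mul_mul_mul_comm ((n : ℂ) ^ (c / 2)), hpow,
    mul_mul_mul_comm ((n : ℂ) ^ ((c + A) / 2)), div_mul_eq_mul_div, h, mul_div_right_comm]

theorem gauss_second_summation (a b : ℂ) (h : NotNonposInt ((a + b + 1)/2)) :
    pFq [a, b] [(a + b + 1)/2] (1/2) =
      Complex.Gamma (1/2) * Complex.Gamma ((a + b + 1)/2) /
        (Complex.Gamma ((a + 1)/2) * Complex.Gamma ((b + 1)/2)) := by
  set c := (a + b + 1) / 2 with hc
  have hB := inv_Gamma_mul_baileySum (A := c - a) h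
  have hd := Complex.Gamma_mul_Gamma_add_half (c / 2)
  rw [show c / 2 + 1 / 2 = (c + 1) / 2 by ring, show 2 * (c / 2) = c by ring] at hd
  rw [show (c + (c - a)) / 2 = (b + 1) / 2 by rw [hc]; ring,
    show (c + 1 - (c - a)) / 2 = (a + 1) / 2 by ring, ← mul_inv, hd] at hB
  have hΓ : Complex.Gamma c ≠ 0 := Complex.Gamma_ne_zero h
  have hπ : (√Real.pi : ℂ) ≠ 0 := by
    exact_mod_cast (Real.sqrt_pos.2 Real.pi_pos).ne'
  have h2 : (2 : ℂ) ^ (1 - c) ≠ 0 := by simp [Complex.cpow_eq_zero_iff]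
  have hpow : (2 : ℂ) ^ (a + b - c) = (2 ^ (1 - c))⁻¹ := by
    rw [← Complex.cpow_neg]; congr 1; rw [hc]; ring
  have hhalf : Complex.Gamma (1 / 2) = √Real.pi := by
    rw [Complex.Gamma_one_half_eq, Real.sqrt_eq_rpow, Complex.ofReal_cpow Real.pi_pos.le]
    norm_num
  have hS : baileySum (c - a) c = ∑' k, gaussCoeff (c - a) (c - b) c k * (1 / 2) ^ k := by
    rw [baileySum, show 1 - (c - a) = c - b by rw [hc]; ring]
  rw [pFq_two_one, tsum_gaussCoeff_euler h, ← hS, hpow, hhalf, div_eq_mul_inv, mul_inv,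
    mul_comm (Complex.Gamma ((a + 1) / 2))⁻¹, ← hB]
  field_simp
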